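/- Assume in addition that H ≠ 0, |H|² ≠ γp, ξ ≠ 0, ξ×H = 0, and τ ∈ ℝ satisfies ρτ² = |H|²|ξ|². Let ∂A/∂ξᵢ denote the entrywise partial derivative of the matrix-valued map ξ ↦ A(ξ). Then for every ν ∈ ℝ⁸ with q(τ,ξ)ν = 0, the vector (ξ₂·(∂A/∂ξ₁)(ξ) − ξ₁·(∂A/∂ξ₂)(ξ))·ν lies in the range of q(τ,ξ). (This verifies, for the rotation field ξ₂∂_{ξ₁} − ξ₁∂_{ξ₂} tangent to the characteristic set, the condition that the derivative of the principal symbol maps its kernel into its image at Σ₂.) -/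

import Mathlib

open Matrix

noncomputable section

/-- Euclidean dot product on `ℝ³`. -/
def dot3 (a b : Fin 3 → ℝ) : ℝ := a 0 * b 0 + a 1 * b 1 + a 2 * b 2

/-- Cross product on `ℝ³`. -/
def cross3 (a b : Fin 3 → ℝ) : Fin 3 → ℝ :=
  ![a 1 * b 2 - a 2 * b 1, a 2 * b 0 - a 0 * b 2, a 0 * b 1 - a 1 * b 0]

/-- The matrix `A(ξ) = q(0,ξ)` of the principal symbol of the linearized ideal
MHD system in the coordinates `(ρ̇,u̇₁,u̇₂,u̇₃,Ḣ₁,Ḣ₂,Ḣ₃,ṗ)`, so that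
`q(τ,ξ) = τ·Id₈ + A(ξ)`. -/
def Amat (ρ γ p : ℝ) (H ξ : Fin 3 → ℝ) : Matrix (Fin 8) (Fin 8) ℝ :=
  !![0, ρ * ξ 0, ρ * ξ 1, ρ * ξ 2, 0, 0, 0, 0;
     0, 0, 0, 0, (ξ 0 * H 0 - dot3 H ξ) / ρ, (ξ 0 * H 1) / ρ, (ξ 0 * H 2) / ρ, ξ 0 / ρ;
     0, 0, 0, 0, (ξ 1 * H 0) / ρ, (ξ 1 * H 1 - dot3 H ξ) / ρ, (ξ 1 * H 2) / ρ, ξ 1 / ρ;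
     0, 0, 0, 0, (ξ 2 * H 0) / ρ, (ξ 2 * H 1) / ρ, (ξ 2 * H 2 - dot3 H ξ) / ρ, ξ 2 / ρ;
     0, H 0 * ξ 0 - dot3 H ξ, H 0 * ξ 1, H 0 * ξ 2, 0, 0, 0, 0;
     0, H 1 * ξ 0, H 1 * ξ 1 - dot3 H ξ, H 1 * ξ 2, 0, 0, 0, 0;
     0, H 2 * ξ 0, H 2 * ξ 1, H 2 * ξ 2 - dot3 H ξ, 0, 0, 0, 0;
     0, γ * p * ξ 0, γ * p * ξ 1, γ * p * ξ 2, 0, 0, 0, 0]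

/-- The entrywise partial derivative `∂A/∂ξᵢ` of `ξ ↦ A(ξ)`. -/
def dAmat (ρ γ p : ℝ) (H : Fin 3 → ℝ) (i : Fin 3) (ξ : Fin 3 → ℝ) :
    Matrix (Fin 8) (Fin 8) ℝ :=
  Matrix.of fun a b =>
    fderiv ℝ (fun ζ => Amat ρ γ p H ζ a b) ξ (Pi.single i 1 : Fin 3 → ℝ)

set_option maxHeartbeats 2000000 in
theorem isLinearMap_Amat_apply (ρ γ p : ℝ) (H : Fin 3 → ℝ) (a b : Fin 8) :
    IsLinearMap ℝ fun ζ => Amat ρ γ p H ζ a b := by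
  constructor
  · intro x y
    fin_cases a <;> fin_cases b <;> simp [Amat, dot3] <;> ring
  · intro c x
    fin_cases a <;> fin_cases b <;> simp [Amat, dot3] <;> ring

/-- Since `A` is linear in `ξ`, its partial derivatives are its values at the basis vectors. -/
theorem dAmat_eq (ρ γ p : ℝ) (H : Fin 3 → ℝ) (i : Fin 3) (ξ : Fin 3 → ℝ) :
    dAmat ρ γ p H i ξ = Amat ρ γ p H (Pi.single i 1) := by
  ext a b
  exact congrArg (fun f => f (Pi.single i 1))
    (ContinuousLinearMap.fderiv
      (isLinearMap_Amat_apply ρ γ p H a b).mk'.toContinuousLinearMap (x := ξ))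

theorem rotation_dAmat (ρ γ p : ℝ) (H ξ : Fin 3 → ℝ) :
    ξ 1 • dAmat ρ γ p H 0 ξ - ξ 0 • dAmat ρ γ p H 1 ξ =
      Amat ρ γ p H ![ξ 1, -ξ 0, 0] := by
  have hv : (![ξ 1, -ξ 0, 0] : Fin 3 → ℝ) =
      ξ 1 • Pi.single 0 1 - ξ 0 • Pi.single 1 1 := by
    ext i
    fin_cases i <;> simp
  ext a b
  have h := isLinearMap_Amat_apply ρ γ p H a b
  rw [hv, h.map_sub, h.map_smul, h.map_smul, dAmat_eq, dAmat_eq]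
  rfl

/-- The action of the symbol `q(τ,ξ)` in coordinates. -/
theorem symbol_mulVec (ρ γ p τ : ℝ) (H ξ : Fin 3 → ℝ) (ν : Fin 8 → ℝ) :
    (τ • (1 : Matrix (Fin 8) (Fin 8) ℝ) + Amat ρ γ p H ξ) *ᵥ ν =
      let s := dot3 ξ ![ν 1, ν 2, ν 3]
      let m := ν 7 + dot3 H ![ν 4, ν 5, ν 6]
      let a := dot3 H ξ
      ![τ * ν 0 + ρ * s,
        τ * ν 1 + (m * ξ 0 - a * ν 4) / ρ,
        τ * ν 2 + (m * ξ 1 - a * ν 5) / ρ,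
        τ * ν 3 + (m * ξ 2 - a * ν 6) / ρ,
        τ * ν 4 + s * H 0 - a * ν 1,
        τ * ν 5 + s * H 1 - a * ν 2,
        τ * ν 6 + s * H 2 - a * ν 3,
        τ * ν 7 + γ * p * s] := by
  rw [add_mulVec, smul_mulVec, one_mulVec]
  ext i
  fin_cases i <;>
    simp [Amat, dotProduct, Fin.sum_univ_succ, dot3] <;> ring

theorem exists_eq_smul_of_cross3_eq_zero {ξ H : Fin 3 → ℝ} (hξ : dot3 ξ ξ ≠ 0)
    (h : cross3 ξ H = 0) : ∃ c : ℝ, H = c • ξ := by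
  have h0 : ξ 1 * H 2 - ξ 2 * H 1 = 0 := congrFun h 0
  have h1 : ξ 2 * H 0 - ξ 0 * H 2 = 0 := congrFun h 1
  have h2 : ξ 0 * H 1 - ξ 1 * H 0 = 0 := congrFun h 2
  refine ⟨dot3 H ξ / dot3 ξ ξ, ?_⟩
  ext i
  rw [Pi.smul_apply, smul_eq_mul, div_mul_eq_mul_div, eq_div_iff hξ]
  fin_cases i <;> simp only [dot3, Fin.zero_eta, Fin.mk_one, Fin.reduceFinMk]
  · linear_combination ξ 2 * h1 - ξ 1 * h2
  · linear_combination ξ 0 * h2 - ξ 2 * h0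
  · linear_combination ξ 1 * h0 - ξ 0 * h1

theorem dot3_self_pos {v : Fin 3 → ℝ} (hv : v ≠ 0) : 0 < dot3 v v := by
  obtain ⟨i, hi⟩ := Function.ne_iff.mp hv
  have hi' : 0 < v i * v i := mul_self_pos.mpr hi
  unfold dot3
  fin_cases i <;> simp only [Fin.zero_eta, Fin.mk_one, Fin.reduceFinMk] at hi' <;>
    nlinarith [mul_self_nonneg (v 0), mul_self_nonneg (v 1), mul_self_nonneg (v 2)]

/-- At the uniaxial intersection (`H ≠ 0`, `|H|² ≠ γp`, `ξ ≠ 0`, `ξ×H = 0`,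
`ρτ² = |H|²|ξ|²`), for every `ν ∈ ker q(τ,ξ)` the vector
`(ξ₂·∂A/∂ξ₁ − ξ₁·∂A/∂ξ₂)·ν` lies in the range of `q(τ,ξ)`. -/
theorem stmt17 (ρ γ p : ℝ) (H ξ : Fin 3 → ℝ) (τ : ℝ)
    (hρ : 0 < ρ) (hγp : 0 < γ * p)
    (hH : H ≠ 0) (hHne : dot3 H H ≠ γ * p)
    (hξ : ξ ≠ 0) (hcross : cross3 ξ H = 0)
    (hτ : ρ * τ ^ 2 = dot3 H H * dot3 ξ ξ) :
    ∀ ν : Fin 8 → ℝ,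
      (τ • (1 : Matrix (Fin 8) (Fin 8) ℝ) + Amat ρ γ p H ξ) *ᵥ ν = 0 →
      (ξ 1 • dAmat ρ γ p H 0 ξ - ξ 0 • dAmat ρ γ p H 1 ξ) *ᵥ ν ∈
        LinearMap.range
          (τ • (1 : Matrix (Fin 8) (Fin 8) ℝ) + Amat ρ γ p H ξ).mulVecLin := by
  intro ν hν
  have hξpos := dot3_self_pos hξ
  have hHpos := dot3_self_pos hH
  have hτ0 : τ ≠ 0 := by
    rintro rfl
    nlinarith [mul_pos hHpos hξpos]
  obtain ⟨c, rfl⟩ := exists_eq_smul_of_cross3_eq_zero hξpos.ne' hcross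
  have hρ0 := hρ.ne'
  set n := dot3 ξ ξ with hn
  have hHH : dot3 (c • ξ) (c • ξ) = c ^ 2 * n := by
    simp [hn, dot3]; ring
  have ha : dot3 (c • ξ) ξ = c * n := by
    simp [hn, dot3]; ring
  rw [hHH] at hHne hτ
  have hgap : γ * p - c ^ 2 * n ≠ 0 := sub_ne_zero.mpr hHne.symm
  rw [symbol_mulVec, ha] at hν
  set s := dot3 ξ ![ν 1, ν 2, ν 3] with hs
  set w := dot3 ξ ![ν 4, ν 5, ν 6] with hw
  have hHw : dot3 (c • ξ) ![ν 4, ν 5, ν 6] = c * w := by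
    simp [hw, dot3]; ring
  rw [hHw] at hν
  have e1 : τ * ν 1 + ((ν 7 + c * w) * ξ 0 - c * n * ν 4) / ρ = 0 := congrFun hν 1
  have e2 : τ * ν 2 + ((ν 7 + c * w) * ξ 1 - c * n * ν 5) / ρ = 0 := congrFun hν 2
  have e3 : τ * ν 3 + ((ν 7 + c * w) * ξ 2 - c * n * ν 6) / ρ = 0 := congrFun hν 3
  have e4 : τ * ν 4 + s * (c * ξ 0) - c * n * ν 1 = 0 := congrFun hν 4
  have e5 : τ * ν 5 + s * (c * ξ 1) - c * n * ν 2 = 0 := congrFun hν 5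
  have e6 : τ * ν 6 + s * (c * ξ 2) - c * n * ν 3 = 0 := congrFun hν 6
  have e7 : τ * ν 7 + γ * p * s = 0 := congrFun hν 7
  have hs' : s = ξ 0 * ν 1 + ξ 1 * ν 2 + ξ 2 * ν 3 := rfl
  have hw' : w = ξ 0 * ν 4 + ξ 1 * ν 5 + ξ 2 * ν 6 := rfl
  have hn' : n = ξ 0 * ξ 0 + ξ 1 * ξ 1 + ξ 2 * ξ 2 := rfl
  clear_value s w n
  have hsP : ρ * τ * s + ν 7 * n = 0 := by
    field_simp at e1 e2 e3
    linear_combination ξ 0 * e1 + ξ 1 * e2 + ξ 2 * e3 + ρ * τ * hs' - c * n * hw'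
      + (ν 7 + c * w) * hn'
  have hs0 : s = 0 := by
    have : n * (γ * p - c ^ 2 * n) * s = 0 := by
      linear_combination n * e7 - τ * hsP + s * hτ
    simpa [hξpos.ne', hgap] using this
  have hP0 : ν 7 = 0 := by simpa [hs0, hτ0] using e7
  have hw0 : w = 0 := by
    have : τ * w = 0 := by
      linear_combination ξ 0 * e4 + ξ 1 * e5 + ξ 2 * e6 + τ * hw' - c * n * hs' + s * c * hn'
    simpa [hτ0] using this
  have hη : dot3 (c • ξ) ![ξ 1, -ξ 0, 0] = 0 := by
    simp [dot3]; ring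
  have hA := symbol_mulVec ρ γ p 0 (c • ξ) ![ξ 1, -ξ 0, 0] ν
  rw [zero_smul, zero_add, hη, hHw, hP0, hw0] at hA
  rw [rotation_dAmat, hA]
  set t := dot3 ![ξ 1, -ξ 0, 0] ![ν 1, ν 2, ν 3]
  have hα : ∃ α, α * (n * (γ * p - c ^ 2 * n)) = γ * p * t :=
    ⟨_, div_mul_cancel₀ _ (mul_ne_zero hξpos.ne' hgap)⟩
  obtain ⟨α, hα⟩ := hα
  have hβ : ∃ β, τ * β = t * c := ⟨_, mul_div_cancel₀ _ hτ0⟩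
  obtain ⟨β, hβ⟩ := hβ
  refine ⟨![ρ * (t - α * n) / τ, α * ξ 0, α * ξ 1, α * ξ 2,
    β * ξ 0, β * ξ 1, β * ξ 2, -ρ * τ * α], ?_⟩
  have hu : dot3 ξ ![α * ξ 0, α * ξ 1, α * ξ 2] = α * n := by
    simp [hn', dot3]; ring
  have hh : dot3 (c • ξ) ![β * ξ 0, β * ξ 1, β * ξ 2] = c * β * n := by
    simp [hn', dot3]; ring
  rw [mulVecLin_apply, symbol_mulVec, ha]
  ext i
  fin_cases i <;> simp [hu, hh]
  · field_simp
    ring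
  · field_simp
    ring
  · field_simp
    ring
  · field_simp
    ring
  · linear_combination ξ 0 * hβ
  · linear_combination ξ 1 * hβ
  · linear_combination ξ 2 * hβ
  · linear_combination hα - α * hτ
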